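/- (Successor-rule content of the theorem for subtrees of the 'first 0' cycle-joining tree T4.) Let N be a set of binary necklaces of length n such that 1^n ∈ N and, for every α ∈ N with α ≠ 1^n, the lexicographically smallest rotation of the word obtained from α by flipping its first 0 (the 0 of smallest index) to 1 belongs to N. Let S = S_N. For a_1a_2⋯a_n ∈ S, let γ = 0 a_2a_3⋯a_n. Define f(a_1⋯a_n) to be the complement of a_1 if γ is a necklace and a_2⋯a_n ā_1 ∈ S, and a_1 otherwise. Then the map g(a_1a_2⋯a_n) = a_2⋯a_n f(a_1a_2⋯a_n) maps S into S and acts as a single cycle on S: for all σ, τ ∈ S there exists m ≥ 0 with g^{(m)}(σ) = τ. Equivalently, f is the successor rule of a universal cycle for S. -/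

import Mathlib

/-- A necklace: a word that is lexicographically less than or equal to
every one of its rotations.  (Over `Bool`, the order is `false < true`.) -/
def IsNecklace {A : Type*} [LinearOrder A] (α : List A) : Prop :=
  ∀ i : ℕ, ¬ List.Lex (· < ·) (α.rotate i) α

/-- The rotation class of `α`: the set of all rotations of `α`. -/
def rotClass {A : Type*} [DecidableEq A] (α : List A) : Finset (List A) :=
  ((List.range α.length).map α.rotate).toFinset

/-- `S_N`: the set of all rotations of all members of `N`. -/
def SN (N : Finset (List Bool)) : Finset (List Bool) :=
  N.biUnion rotClass

open scoped Classical in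
/-- The shift map `g(a₁a₂⋯aₙ) = a₂⋯aₙ f(a₁a₂⋯aₙ)` for the successor rule `f` of the
'first 0' tree: with `γ = 0a₂a₃⋯aₙ`, we have `f = ā₁` if `γ` is a necklace and
`a₂⋯aₙā₁ ∈ S`, and `f = a₁` otherwise. -/
noncomputable def gFirstZero (S : Finset (List Bool)) (w : List Bool) : List Bool :=
  let γ := false :: w.drop 1
  let b := if IsNecklace γ ∧ w.drop 1 ++ [!w.headI] ∈ S then !w.headI else w.headI
  w.drop 1 ++ [b]

theorem IsNecklace.eq_of_rotate {α : List Bool} {i : ℕ} (hα : IsNecklace α)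
    (h : IsNecklace (α.rotate i)) : α.rotate i = α := by
  obtain ⟨j, hj⟩ : (α.rotate i).IsRotated α := List.IsRotated.forall α i
  have h₂ := h j
  rw [hj] at h₂
  exact le_antisymm (not_lt.mp h₂) (not_lt.mp (hα i))

theorem exists_isNecklace_rotate {w : List Bool} (hw : 0 < w.length) :
    ∃ i, IsNecklace (w.rotate i) := by
  obtain ⟨i, -, hi⟩ := Finset.exists_min_image (Finset.range w.length)
    (fun i => w.rotate i) ⟨0, by simpa using hw⟩
  refine ⟨i, fun j => ?_⟩
  change ¬ (w.rotate i).rotate j < w.rotate i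
  rw [not_lt, List.rotate_rotate, ← List.rotate_mod w (i + j)]
  exact hi _ (Finset.mem_range.mpr (Nat.mod_lt _ hw))

theorem IsNecklace.eq_false_cons {α : List Bool} (hα : IsNecklace α)
    (hne : α ≠ List.replicate α.length true) : ∃ x, α = false :: x := by
  have hmem : false ∈ α := by
    by_contra h
    refine hne (List.eq_replicate_of_mem fun b hb => ?_)
    cases b
    · exact absurd hb h
    · rfl
  match α, hα, hmem with
  | false :: x, _, _ => exact ⟨x, rfl⟩
  | true :: x, hα, hmem =>
    obtain ⟨s, t, hst⟩ := List.append_of_mem hmem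
    refine absurd ?_ (hα s.length)
    rw [show (true :: x).rotate s.length = false :: t ++ s by
      rw [hst, List.rotate_append_length_eq]]
    exact List.Lex.rel (by decide)

theorem mem_SN_of_rotate {N : Finset (List Bool)} {α : List Bool} (hα : α ∈ N) (h : α ≠ [])
    (i : ℕ) : α.rotate i ∈ SN N := by
  simp only [SN, rotClass, Finset.mem_biUnion, List.mem_toFinset, List.mem_map, List.mem_range]
  exact ⟨α, hα, i % α.length, Nat.mod_lt _ (List.length_pos_iff.mpr h), List.rotate_mod α i⟩

theorem exists_of_mem_SN {N : Finset (List Bool)} {w : List Bool} (hw : w ∈ SN N) :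
    ∃ α ∈ N, ∃ i < α.length, w = α.rotate i := by
  simp only [SN, rotClass, Finset.mem_biUnion, List.mem_toFinset, List.mem_map,
    List.mem_range] at hw
  obtain ⟨α, hα, i, hi, rfl⟩ := hw
  exact ⟨α, hα, i, hi, rfl⟩

theorem rotate_mem_SN {N : Finset (List Bool)} {w : List Bool} (hw : w ∈ SN N) (i : ℕ) :
    w.rotate i ∈ SN N := by
  obtain ⟨α, hα, j, hj, rfl⟩ := exists_of_mem_SN hw
  rw [List.rotate_rotate]
  exact mem_SN_of_rotate hα (List.length_pos_iff.mp (by omega)) _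

theorem append_singleton_mem_SN_iff {N : Finset (List Bool)} {x : List Bool} {a : Bool} :
    x ++ [a] ∈ SN N ↔ a :: x ∈ SN N := by
  constructor
  · intro h
    simpa using rotate_mem_SN h x.length
  · intro h
    simpa using rotate_mem_SN h 1

theorem mem_of_mem_SN_of_isNecklace {N : Finset (List Bool)} (hN : ∀ α ∈ N, IsNecklace α)
    {w : List Bool} (hw : w ∈ SN N) (h : IsNecklace w) : w ∈ N := by
  obtain ⟨α, hα, i, -, rfl⟩ := exists_of_mem_SN hw
  rwa [(hN α hα).eq_of_rotate h]

/-- If `N` is closed under flipping a leading `0`, the rule complements `a` in `a :: x` exactly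
when `0x ∈ N`. -/
theorem gFirstZero_cons {N : Finset (List Bool)} (hN : ∀ α ∈ N, IsNecklace α)
    (hflip : ∀ x, false :: x ∈ N → true :: x ∈ SN N) {a : Bool} {x : List Bool}
    (hw : a :: x ∈ SN N) :
    gFirstZero (SN N) (a :: x) = x ++ [if false :: x ∈ N then !a else a] := by
  have key : (IsNecklace (false :: x) ∧ x ++ [!a] ∈ SN N) ↔ false :: x ∈ N := by
    rw [append_singleton_mem_SN_iff]
    constructor
    · rintro ⟨h, h'⟩
      refine mem_of_mem_SN_of_isNecklace hN ?_ h
      cases a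
      · exact hw
      · exact h'
    · intro h
      refine ⟨hN _ h, ?_⟩
      cases a
      · exact hflip x h
      · simpa using mem_SN_of_rotate h (by simp) 0
  simp [gFirstZero, key]

/-- `v` lies on the forward orbit of `u` under `g`. -/
def OrbitReaches {A : Type*} (g : A → A) (u v : A) : Prop :=
  ∃ m : ℕ, g^[m] u = v

theorem OrbitReaches.refl {A : Type*} (g : A → A) (u : A) : OrbitReaches g u u := ⟨0, rfl⟩

theorem OrbitReaches.of_eq {A : Type*} {g : A → A} {u v : A} (h : g u = v) :
    OrbitReaches g u v := ⟨1, h⟩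

theorem OrbitReaches.trans {A : Type*} {g : A → A} {u v w : A} (h₁ : OrbitReaches g u v)
    (h₂ : OrbitReaches g v w) : OrbitReaches g u w := by
  obtain ⟨a, rfl⟩ := h₁
  obtain ⟨b, rfl⟩ := h₂
  exact ⟨b + a, Function.iterate_add_apply g b a u⟩

section Rotations

variable {A : Type*} {g : List A → List A} {α : List A}

theorem orbitReaches_self_of_rotate
    (h : ∀ i, α.rotate i ≠ α → OrbitReaches g (α.rotate i) (α.rotate (i + 1))) :
    ∀ k i, α.rotate (i + k) = α → OrbitReaches g (α.rotate i) α := by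
  intro k
  induction k with
  | zero =>
    intro i hi
    rw [show α.rotate i = α from hi]
    exact .refl g α
  | succ k ih =>
    intro i hi
    by_cases hα : α.rotate i = α
    · rw [hα]
      exact .refl g α
    · exact (h i hα).trans (ih (i + 1) (by rwa [add_assoc, add_comm 1 k]))

theorem orbitReaches_rotate_of_rotate_one
    (h : ∀ i, α.rotate i ≠ α → OrbitReaches g (α.rotate i) (α.rotate (i + 1))) (i : ℕ) :
    OrbitReaches g (α.rotate 1) (α.rotate (i + 1)) := by
  induction i with
  | zero => exact .refl g _
  | succ i ih =>
    by_cases hα : α.rotate (i + 1) = α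
    · rw [← List.rotate_rotate α (i + 1) 1, hα]
      exact .refl g _
    · exact ih.trans (h (i + 1) hα)

end Rotations

section CycleJoining

variable {N : Finset (List Bool)}

/-- Away from the necklaces `0x ∈ N`, the orbit of `w` passes through the rotation of `w`:
if the rule leaves the rotation class of `w`, it comes back after traversing a subtree. -/
theorem orbitReaches_rotate_one (hN : ∀ α ∈ N, IsNecklace α)
    (hflip : ∀ x, false :: x ∈ N → true :: x ∈ SN N) (k : ℕ) :
    ∀ w ∈ SN N, w.count true = k → (w ∈ N → w.headI = true) →
      OrbitReaches (gFirstZero (SN N)) w (w.rotate 1) := by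
  induction k using Nat.strong_induction_on with
  | _ k ih =>
  intro w hw hk hhead
  match w with
  | [] => exact .refl _ _
  | a :: x =>
  by_cases hx : false :: x ∈ N
  · obtain rfl : a = true := by
      cases a
      · exact hhead hx
      · rfl
    have hS : false :: x ∈ SN N := by simpa using mem_SN_of_rotate hx (by simp) 0
    have hstep : ∀ i, (false :: x).rotate i ≠ false :: x →
        OrbitReaches (gFirstZero (SN N)) ((false :: x).rotate i)
          ((false :: x).rotate (i + 1)) := by
      intro i hi
      rw [← List.rotate_rotate]
      refine ih (x.count true) (by simp at hk; omega) _ (rotate_mem_SN hS i) ?_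
        fun h => absurd ((hN _ hx).eq_of_rotate (hN _ h)) hi
      rw [(List.rotate_perm _ i).count_eq]
      simp
    have hback := orbitReaches_self_of_rotate hstep x.length 1
      (by rw [add_comm]; exact List.rotate_length (false :: x))
    have hdown := gFirstZero_cons hN hflip hw
    have hup := gFirstZero_cons hN hflip hS
    simp only [hx, if_true, Bool.not_true, Bool.not_false] at hdown hup
    have h₁ : (false :: x).rotate 1 = x ++ [false] := by simp
    have h₂ : (true :: x).rotate 1 = x ++ [true] := by simp
    rw [h₁] at hback
    rw [h₂]
    exact (OrbitReaches.of_eq hdown).trans (hback.trans (.of_eq hup))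
  · refine .of_eq ?_
    rw [gFirstZero_cons hN hflip hw]
    simp [hx]

theorem orbitReaches_rotate_succ (hN : ∀ α ∈ N, IsNecklace α)
    (hflip : ∀ x, false :: x ∈ N → true :: x ∈ SN N) {α : List Bool} (hα : α ∈ N)
    (hne : α ≠ []) (i : ℕ) (hi : α.rotate i ≠ α) :
    OrbitReaches (gFirstZero (SN N)) (α.rotate i) (α.rotate (i + 1)) := by
  rw [← List.rotate_rotate]
  exact orbitReaches_rotate_one hN hflip _ _ (mem_SN_of_rotate hα hne i) rfl
    fun h => absurd ((hN _ hα).eq_of_rotate (hN _ h)) hi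

theorem orbitReaches_replicate_true (hN : ∀ α ∈ N, IsNecklace α)
    (hflip : ∀ x, false :: x ∈ N → true :: x ∈ SN N) (k : ℕ) :
    ∀ w ∈ SN N, w.count false = k →
      OrbitReaches (gFirstZero (SN N)) w (List.replicate w.length true) ∧
      OrbitReaches (gFirstZero (SN N)) (List.replicate w.length true) w := by
  induction k using Nat.strong_induction_on with
  | _ k ih =>
  intro w hw hk
  obtain ⟨α, hα, i, hi, rfl⟩ := exists_of_mem_SN hw
  rw [List.length_rotate]
  by_cases hroot : α = List.replicate α.length true
  · rw [hroot, List.rotate_replicate, List.length_replicate]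
    exact ⟨.refl _ _, .refl _ _⟩
  obtain ⟨x, rfl⟩ := (hN α hα).eq_false_cons hroot
  have hstep := orbitReaches_rotate_succ hN hflip hα (by simp)
  rw [(List.rotate_perm _ i).count_eq] at hk
  simp only [List.count_cons_self] at hk
  have hS : false :: x ∈ SN N := by simpa using mem_SN_of_rotate hα (by simp) 0
  have hdown := gFirstZero_cons hN hflip (hflip x hα)
  have hup := gFirstZero_cons hN hflip hS
  simp only [hα, if_true, Bool.not_true, Bool.not_false] at hdown hup
  constructor
  · have hself := orbitReaches_self_of_rotate hstep ((false :: x).length - i) i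
      (by rw [Nat.add_sub_cancel' hi.le, List.rotate_length])
    have hparent := (ih (x.count false) (by omega) (x ++ [true])
      (append_singleton_mem_SN_iff.mpr (hflip x hα)) (by simp)).1
    rw [show (x ++ [true]).length = (false :: x).length by simp] at hparent
    exact hself.trans ((OrbitReaches.of_eq hup).trans hparent)
  · have hparent := (ih (x.count false) (by omega) (true :: x) (hflip x hα) (by simp)).2
    have hclass := orbitReaches_rotate_of_rotate_one hstep (x.length + i)
    rw [show x.length + i + 1 = (false :: x).length + i by simp; omega,
      ← List.rotate_rotate, List.rotate_length,
      show (false :: x).rotate 1 = x ++ [false] by simp] at hclass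
    exact hparent.trans ((OrbitReaches.of_eq hdown).trans hclass)

end CycleJoining

theorem stmt11 {n : ℕ} (hn : 1 ≤ n)
    (N : Finset (List Bool))
    (hNneck : ∀ α ∈ N, α.length = n ∧ IsNecklace α)
    (hroot : List.replicate n true ∈ N)
    (hclosed : ∀ α ∈ N, α ≠ List.replicate n true → ∀ j, j < n →
      α[j]? = some false → (∀ i, i < j → α[i]? = some true) →
      ∀ β, (∃ i : ℕ, β = (α.set j true).rotate i) → IsNecklace β → β ∈ N) :
    (∀ w ∈ SN N, gFirstZero (SN N) w ∈ SN N) ∧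
    ∀ σ ∈ SN N, ∀ τ ∈ SN N, ∃ m : ℕ, (gFirstZero (SN N))^[m] σ = τ := by
  have hN : ∀ α ∈ N, IsNecklace α := fun α hα => (hNneck α hα).2
  have hlen : ∀ w ∈ SN N, w.length = n := by
    intro w hw
    obtain ⟨α, hα, i, -, rfl⟩ := exists_of_mem_SN hw
    rw [List.length_rotate, (hNneck α hα).1]
  have hflip : ∀ x, false :: x ∈ N → true :: x ∈ SN N := by
    intro x hx
    obtain ⟨i, hi⟩ := exists_isNecklace_rotate (w := true :: x) (by simp)
    have hmem : (true :: x).rotate i ∈ N := by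
      refine hclosed _ hx ?_ 0 hn (by simp) (by simp) _ ⟨i, by simp⟩ hi
      intro h
      have : false ∈ List.replicate n true := h ▸ List.mem_cons_self
      simp at this
    obtain ⟨j, hj⟩ : ((true :: x).rotate i).IsRotated (true :: x) := List.IsRotated.forall _ i
    rw [← hj]
    exact mem_SN_of_rotate hmem (by simp) j
  refine ⟨fun w hw => ?_, fun σ hσ τ hτ => ?_⟩
  · match w with
    | [] => exact absurd (hlen _ hw) (by simp; omega)
    | a :: x =>
    rw [gFirstZero_cons hN hflip hw, append_singleton_mem_SN_iff]
    split_ifs with hx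
    · cases a
      · exact hflip x hx
      · simpa using mem_SN_of_rotate hx (by simp) 0
    · exact hw
  · have h₁ := (orbitReaches_replicate_true hN hflip _ σ hσ rfl).1
    have h₂ := (orbitReaches_replicate_true hN hflip _ τ hτ rfl).2
    rw [hlen σ hσ] at h₁
    rw [hlen τ hτ] at h₂
    exact h₁.trans h₂
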